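/- Let n ≥ 1 and M ≥ 1, let (Ω, P) be a probability space, and let ε₁, …, ε_n be random variables taking values in [0, 1]. Let R be a symmetric relation on {1, …, n} such that Cov(ε_i, ε_j) = 0 whenever i ≠ j and (i, j) ∉ R, and such that for every i the number of indices j with (i, j) ∈ R is at most M. Set W := (1/n) ∑_{i=1}^n ε_i. Then for every real k > 0, P( |W − E[W]| ≥ k · √(2M/n) ) ≤ 1/k². -/

import Mathlib

open MeasureTheory

/-- Covariance of two real random variables: `E[f g] - E[f] E[g]`. -/
noncomputable def cov {Ω : Type*} [MeasurableSpace Ω] (μ : Measure Ω) (f g : Ω → ℝ) : ℝ :=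
  (∫ ω, f ω * g ω ∂μ) - (∫ ω, f ω ∂μ) * (∫ ω, g ω ∂μ)

/-- `cov` agrees with `ProbabilityTheory.covariance` on square-integrable variables. -/
theorem cov_eq_covariance {Ω : Type*} [MeasurableSpace Ω] {μ : Measure Ω} [IsProbabilityMeasure μ]
    {f g : Ω → ℝ} (hf : MemLp f 2 μ) (hg : MemLp g 2 μ) :
    cov μ f g = ProbabilityTheory.covariance f g μ :=
  (ProbabilityTheory.covariance_eq_sub hf hg).symm

theorem cov_le_one {Ω : Type*} [MeasurableSpace Ω] (μ : Measure Ω) [IsProbabilityMeasure μ]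
    {f g : Ω → ℝ} (hf : ∀ ω, f ω ∈ Set.Icc (0 : ℝ) 1) (hg : ∀ ω, g ω ∈ Set.Icc (0 : ℝ) 1) :
    cov μ f g ≤ 1 := by
  have hf0 : 0 ≤ ∫ ω, f ω ∂μ := integral_nonneg fun ω => (hf ω).1
  have hg0 : 0 ≤ ∫ ω, g ω ∂μ := integral_nonneg fun ω => (hg ω).1
  have hfg : ∫ ω, f ω * g ω ∂μ ≤ 1 := by
    have h := integral_mono_of_nonneg (μ := μ) (f := fun ω => f ω * g ω) (g := fun _ => 1)
      (ae_of_all _ fun ω => mul_nonneg (hf ω).1 (hg ω).1) (integrable_const 1)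
      (ae_of_all _ fun ω => mul_le_one₀ (hf ω).2 (hg ω).1 (hg ω).2)
    simpa using h
  unfold cov
  nlinarith [mul_nonneg hf0 hg0]

/-- Variance of a sum of `[0,1]`-valued variables whose dependency relation has degree at most
`M`. -/
theorem variance_sum_le_of_dependency {Ω ι : Type*} [MeasurableSpace Ω] [Fintype ι] (μ : Measure Ω)
    [IsProbabilityMeasure μ] {M : ℕ} {X : ι → Ω → ℝ} (hX : ∀ i, MemLp (X i) 2 μ)
    (hbd : ∀ i ω, X i ω ∈ Set.Icc (0 : ℝ) 1) {R : ι → ι → Prop}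
    (hzero : ∀ i j, i ≠ j → ¬ R i j → cov μ (X i) (X j) = 0)
    (hdeg : ∀ i, Set.ncard {j | R i j} ≤ M) :
    ProbabilityTheory.variance (fun ω => ∑ i, X i ω) μ ≤ Fintype.card ι * (M + 1) := by
  classical
  rw [ProbabilityTheory.variance_fun_sum hX]
  have hrow : ∀ i, ∑ j, ProbabilityTheory.covariance (X i) (X j) μ ≤ (M : ℝ) + 1 := fun i => by
    calc ∑ j, ProbabilityTheory.covariance (X i) (X j) μ
        = ∑ j ∈ insert i {j | R i j}.toFinset, ProbabilityTheory.covariance (X i) (X j) μ := by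
          refine (Finset.sum_subset (Finset.subset_univ _) fun j _ hj => ?_).symm
          simp only [Finset.mem_insert, Set.mem_toFinset, Set.mem_ofPred_eq, not_or] at hj
          rw [← cov_eq_covariance (hX i) (hX j), hzero i j (Ne.symm hj.1) hj.2]
      _ ≤ (insert i {j | R i j}.toFinset).card • (1 : ℝ) :=
          Finset.sum_le_card_nsmul _ _ _ fun j _ =>
            (cov_eq_covariance (hX i) (hX j)).symm.trans_le (cov_le_one μ (hbd i) (hbd j))
      _ ≤ (M : ℝ) + 1 := by
          rw [nsmul_one]
          have h := hdeg i
          rw [Set.ncard_eq_toFinset_card'] at h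
          exact_mod_cast (Finset.card_insert_le _ _).trans (Nat.add_le_add_right h 1)
  calc _ ≤ ∑ _i : ι, ((M : ℝ) + 1) := Finset.sum_le_sum fun i _ => hrow i
    _ = _ := by simp [mul_add]

/-- Chebyshev-type concentration for the average `W = (1/n) ∑ ε_i` of `[0,1]`-valued random
variables with dependency relation `R` of degree at most `M`:
`P(|W - E[W]| ≥ k √(2M/n)) ≤ 1/k²`. -/
theorem stmt10 {Ω : Type*} [MeasurableSpace Ω] (μ : Measure Ω) [IsProbabilityMeasure μ]
    (n M : ℕ) (hn : 1 ≤ n) (hM : 1 ≤ M)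
    (ε : Fin n → Ω → ℝ) (hmeas : ∀ i, Measurable (ε i))
    (hbd : ∀ i ω, ε i ω ∈ Set.Icc (0 : ℝ) 1)
    (R : Fin n → Fin n → Prop) (hsymm : ∀ i j, R i j → R j i)
    (hzero : ∀ i j, i ≠ j → ¬ R i j → cov μ (ε i) (ε j) = 0)
    (hdeg : ∀ i, Set.ncard {j | R i j} ≤ M)
    (k : ℝ) (hk : 0 < k) :
    μ {ω | k * Real.sqrt (2 * (M : ℝ) / n) ≤
        |(1 / (n : ℝ)) * ∑ i, ε i ω - ∫ ω', (1 / (n : ℝ)) * ∑ i, ε i ω' ∂μ|} ≤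
      ENNReal.ofReal (1 / k ^ 2) := by
  have hn0 : (0 : ℝ) < n := by exact_mod_cast hn
  have hM1 : (1 : ℝ) ≤ M := by exact_mod_cast hM
  have hL : ∀ i, MemLp (ε i) 2 μ := fun i =>
    memLp_of_bounded (ae_of_all _ (hbd i)) (hmeas i).aestronglyMeasurable 2
  have hvar : ProbabilityTheory.variance (fun ω => (1 / (n : ℝ)) * ∑ i, ε i ω) μ ≤ 2 * M / n := by
    rw [ProbabilityTheory.variance_const_mul]
    have h := variance_sum_le_of_dependency μ hL hbd hzero hdeg
    rw [Fintype.card_fin] at h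
    calc _ ≤ (1 / (n : ℝ)) ^ 2 * (n * (2 * M)) := by
          gcongr
          exact h.trans (by gcongr; linarith)
      _ = 2 * M / n := by field_simp
  have hpos : (0 : ℝ) < 2 * M / n := by positivity
  refine (ProbabilityTheory.meas_ge_le_variance_div_sq
    ((memLp_finsetSum _ fun i _ => hL i).const_mul _)
    (mul_pos hk (Real.sqrt_pos.2 hpos))).trans (ENNReal.ofReal_le_ofReal ?_)
  rw [mul_pow, Real.sq_sqrt hpos.le, div_le_div_iff₀ (by positivity) (by positivity)]
  nlinarith [mul_le_mul_of_nonneg_right hvar (sq_nonneg k)]
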